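/- Suppose g : [t₀,∞) → ℝ is continuous with g(t) < 0 for all large t and ∫_{t₀}^t g(s) ds → −∞ as t → ∞, and w : [t₀,∞) → [0,∞) is continuous with w(t)/g(t) → 0 as t → ∞. Then exp(∫_{t₀}^t g(s) ds) · ∫_{t₀}^t exp(−∫_{t₀}^τ g(s) ds) w(τ) dτ → 0 as t → ∞. -/

import Mathlib

open Filter Topology

/-- The conclusion of `stmt14` for functions that are continuous on the whole line. -/
theorem tendsto_exp_integral_mul_integral_of_continuous (t₀ : ℝ) {g w : ℝ → ℝ}
    (hg : Continuous g) (hw : Continuous w)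
    (hw0 : ∀ t ≥ t₀, 0 ≤ w t)
    (hgneg : ∀ᶠ t in atTop, g t < 0)
    (hgint : Tendsto (fun t => ∫ s in t₀..t, g s) atTop atBot)
    (hquot : Tendsto (fun t => w t / g t) atTop (𝓝 0)) :
    Tendsto
      (fun t => Real.exp (∫ s in t₀..t, g s) *
        ∫ τ in t₀..t, Real.exp (-∫ s in t₀..τ, g s) * w τ)
      atTop (𝓝 0) := by
  set G : ℝ → ℝ := fun t => ∫ s in t₀..t, g s with hG
  set F : ℝ → ℝ := fun t => ∫ τ in t₀..t, Real.exp (-G τ) * w τ with hF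
  have hG' (t : ℝ) : HasDerivAt G (g t) t := hg.integral_hasStrictDerivAt t₀ t |>.hasDerivAt
  have hGc : Continuous G := continuous_iff_continuousAt.2 fun t => (hG' t).continuousAt
  have hF' (t : ℝ) : HasDerivAt F (Real.exp (-G t) * w t) t :=
    Continuous.integral_hasStrictDerivAt (by fun_prop) t₀ t |>.hasDerivAt
  have hE' (t : ℝ) : HasDerivAt (fun t => Real.exp (-G t)) (Real.exp (-G t) * -g t) t :=
    (hG' t).neg.exp
  have hE0 : Tendsto (fun t => Real.exp (G t)) atTop (𝓝 0) :=
    Real.tendsto_exp_atBot.comp hgint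
  have hF0 : ∀ t ≥ t₀, 0 ≤ F t := fun t ht =>
    intervalIntegral.integral_nonneg ht fun u hu =>
      mul_nonneg (Real.exp_pos _).le (hw0 u hu.1)
  change Tendsto (fun t => Real.exp (G t) * F t) atTop (𝓝 0)
  rw [Metric.tendsto_nhds]
  intro ε hε
  have hlow : ∀ᶠ t in atTop, -(ε / 2) < w t / g t :=
    hquot.eventually (lt_mem_nhds (by linarith))
  obtain ⟨T, hT⟩ := eventually_atTop.1 (hgneg.and hlow)
  have hanti : AntitoneOn (fun t => F t - ε / 2 * Real.exp (-G t)) (Set.Ici T) := by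
    have hd (t : ℝ) := (hF' t).sub ((hE' t).const_mul (ε / 2))
    refine antitoneOn_of_hasDerivWithinAt_nonpos (convex_Ici T)
      (fun t _ => (hd t).continuousAt.continuousWithinAt)
      (fun t _ => (hd t).hasDerivWithinAt) fun t ht => ?_
    obtain ⟨hneg, hlt⟩ := hT t (interior_subset ht)
    rw [lt_div_iff_of_neg hneg] at hlt
    nlinarith [Real.exp_pos (-G t)]
  have hlim : Tendsto (fun t => Real.exp (G t) * (F T - ε / 2 * Real.exp (-G T))) atTop (𝓝 0) := by
    simpa using hE0.mul_const (F T - ε / 2 * Real.exp (-G T))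
  filter_upwards [eventually_ge_atTop T, eventually_ge_atTop t₀,
    hlim.eventually (gt_mem_nhds (half_pos hε))] with t htT ht₀ hsmall
  have hle := mul_le_mul_of_nonneg_left (hanti Set.self_mem_Ici htT htT) (Real.exp_pos (G t)).le
  have hinv : Real.exp (G t) * Real.exp (-G t) = 1 := by rw [← Real.exp_add]; simp
  rw [Real.dist_0_eq_abs, abs_of_nonneg (mul_nonneg (Real.exp_pos _).le (hF0 t ht₀))]
  simp only at hle
  linear_combination hle + hsmall + ε / 2 * hinv

/-- scalar lemma. If `g` is continuous with `g(t) < 0` for all large `t` and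
`∫_{t₀}^t g → −∞`, and `w ≥ 0` is continuous with `w(t)/g(t) → 0` as `t → ∞`, then
`exp(∫_{t₀}^t g) · ∫_{t₀}^t exp(−∫_{t₀}^τ g) w(τ) dτ → 0` as `t → ∞`. -/
theorem stmt14 (t₀ : ℝ) (g w : ℝ → ℝ)
    (hg : ContinuousOn g (Set.Ici t₀)) (hw : ContinuousOn w (Set.Ici t₀))
    (hw0 : ∀ t ≥ t₀, 0 ≤ w t)
    (hgneg : ∀ᶠ t in atTop, g t < 0)
    (hgint : Tendsto (fun t => ∫ s in t₀..t, g s) atTop atBot)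
    (hquot : Tendsto (fun t => w t / g t) atTop (𝓝 0)) :
    Tendsto
      (fun t => Real.exp (∫ s in t₀..t, g s) *
        ∫ τ in t₀..t, Real.exp (-∫ s in t₀..τ, g s) * w τ)
      atTop (𝓝 0) := by
  have hmax : Continuous fun t : ℝ => max t₀ t := by fun_prop
  have hcont {h : ℝ → ℝ} (hh : ContinuousOn h (Set.Ici t₀)) :
      Continuous fun t => h (max t₀ t) :=
    hh.comp_continuous hmax fun t => le_max_left t₀ t
  have hG (t : ℝ) (ht : t₀ ≤ t) : ∫ s in t₀..t, g (max t₀ s) = ∫ s in t₀..t, g s :=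
    intervalIntegral.integral_congr fun s hs =>
      congrArg g (max_eq_right (Set.uIcc_of_le ht ▸ hs).1)
  have hev := eventually_ge_atTop t₀
  refine (tendsto_exp_integral_mul_integral_of_continuous t₀ (hcont hg) (hcont hw)
    (fun t _ => hw0 _ (le_max_left t₀ t)) ?_ (hgint.congr' ?_) (hquot.congr' ?_)).congr' ?_
  · filter_upwards [hev, hgneg] with t ht hneg
    rwa [max_eq_right ht]
  · filter_upwards [hev] with t ht using (hG t ht).symm
  · filter_upwards [hev] with t ht
    rw [max_eq_right ht]
  · filter_upwards [hev] with t ht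
    rw [hG t ht]
    congr 1
    refine intervalIntegral.integral_congr fun τ hτ => ?_
    have hτ₀ : t₀ ≤ τ := (Set.uIcc_of_le ht ▸ hτ).1
    simp only [hG τ hτ₀, max_eq_right hτ₀]
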